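/- arXiv:1110.2841 — 2 statements merged into one kernel-verified Lean document; each statement's English description precedes it below -/
import Mathlib

section
/- Let 𝒞 be a hereditary class of finite simple graphs such that every G ∈ 𝒞 having at least one edge contains a vertex v with i(G) ≤ i(G − v). Then every G ∈ 𝒞 on n vertices satisfies pd(G) = n − i(G). -/
open CategoryTheory
open scoped ENNReal

noncomputable def projDim (R : Type) [CommRing R] (M : ModuleCat R) : ℕ∞ :=
  sSup {n : ℕ∞ | ∃ (i : ℕ) (N : ModuleCat R), n = i ∧
    Nontrivial (((Ext R (ModuleCat R) i).obj (Opposite.op M)).obj N)}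

noncomputable def edgeIdeal (K : Type) [Field K] {V : Type} (G : SimpleGraph V) :
    Ideal (MvPolynomial V K) :=
  Ideal.span {m | ∃ u v, G.Adj u v ∧ m = MvPolynomial.X u * MvPolynomial.X v}

noncomputable def graphPd (K : Type) [Field K] {V : Type} (G : SimpleGraph V) : ℕ∞ :=
  projDim (MvPolynomial V K)
    (ModuleCat.of (MvPolynomial V K) (MvPolynomial V K ⧸ edgeIdeal K G))

/-- `A` is a dominating set: every vertex outside `A` has a neighbor in `A`. -/
def IsDominatingSet {V : Type} (G : SimpleGraph V) (A : Set V) : Prop :=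
  ∀ v ∉ A, ∃ a ∈ A, G.Adj v a

/-- A set of vertices is independent if no two of its vertices are adjacent. -/
def IsIndepSet {V : Type} (G : SimpleGraph V) (A : Set V) : Prop :=
  ∀ u ∈ A, ∀ v ∈ A, ¬ G.Adj u v

/-- `γ(G)`: the minimum size of a dominating set. -/
noncomputable def domNum {V : Type} (G : SimpleGraph V) : ℕ :=
  sInf {n | ∃ A : Set V, IsDominatingSet G A ∧ A.ncard = n}

/-- `i(G)`: the minimum size of an independent dominating set. -/
noncomputable def indDomNum {V : Type} (G : SimpleGraph V) : ℕ :=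
  sInf {n | ∃ A : Set V, IsDominatingSet G A ∧ IsIndepSet G A ∧ A.ncard = n}

/-- `γ₀(X, G)`: the minimum size of a set `A` with `X ⊆ N(A)`. -/
noncomputable def gamma0Of {V : Type} (G : SimpleGraph V) (X : Set V) : ℕ :=
  sInf {n | ∃ A : Set V, (∀ x ∈ X, ∃ a ∈ A, G.Adj x a) ∧ A.ncard = n}

/-- `γ₀(G) = γ₀(V(G), G)`. -/
noncomputable def gamma0 {V : Type} (G : SimpleGraph V) : ℕ :=
  gamma0Of G Set.univ

/-- `τ(G)`: the maximum of `γ₀(A, G)` over independent sets `A`. -/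
noncomputable def tauNum {V : Type} (G : SimpleGraph V) : ℕ :=
  sSup {n | ∃ A : Set V, IsIndepSet G A ∧ gamma0Of G A = n}

/-- A set `F` of edges of `G` is edgewise dominant if every vertex of `G` is adjacent
to an endpoint of some edge in `F`. -/
def IsEdgewiseDominant {V : Type} (G : SimpleGraph V) (F : Set (Sym2 V)) : Prop :=
  F ⊆ G.edgeSet ∧ ∀ v : V, ∃ e ∈ F, ∃ w, w ∈ e ∧ G.Adj v w

/-- `ε(G)`: the minimum size of an edgewise dominant set of edges. -/
noncomputable def epsilonNum {V : Type} (G : SimpleGraph V) : ℕ :=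
  sInf {n | ∃ F : Set (Sym2 V), IsEdgewiseDominant G F ∧ F.ncard = n}

section Homological

variable {R : Type} [CommRing R]

lemma subsingleton_ext_iff_subsingleton_abelianExt (M N : ModuleCat.{0} R) (n : ℕ) :
    Subsingleton (((Ext R (ModuleCat R) (n + 1)).obj (Opposite.op M)).obj N) ↔
      Subsingleton (Abelian.Ext M N (n + 1)) := by
  let P := ProjectiveResolution.of M
  rw [← ModuleCat.isZero_iff_subsingleton, (P.isoExt (R := R) (n + 1) N).isZero_iff,
    ← HomologicalComplex.exactAt_iff_isZero_homology,
    HomologicalComplex.exactAt_iff' _ n (n + 1) (n + 2) (by simp) (by simp),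
    ShortComplex.moduleCat_exact_iff]
  constructor
  · intro h
    refine subsingleton_of_forall_eq 0 fun e ↦ ?_
    obtain ⟨f, hf, rfl⟩ := P.extMk_surjective e (n + 2) rfl
    rw [P.extMk_eq_zero_iff _ _ _ _ n rfl]
    exact h f hf
  · intro h f hf
    have := P.extMk_eq_zero_iff f (n + 2) rfl hf n rfl
    exact this.1 (Subsingleton.elim _ _)

lemma projDim_eq_of_hasProjectiveDimensionLT {M : ModuleCat.{0} R} {d : ℕ}
    (h : HasProjectiveDimensionLT M (d + 1)) (h' : ¬ HasProjectiveDimensionLT M d) :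
    projDim R M = d := by
  apply le_antisymm
  · refine sSup_le ?_
    rintro _ ⟨i, N, rfl, hN⟩
    by_contra! hlt
    obtain ⟨j, rfl⟩ : ∃ j, i = j + 1 := ⟨i - 1, by have := Nat.cast_lt.1 hlt; omega⟩
    rw [← not_subsingleton_iff_nontrivial, subsingleton_ext_iff_subsingleton_abelianExt] at hN
    exact hN (HasProjectiveDimensionLT.subsingleton M (d + 1) (j + 1) (Nat.cast_lt.1 hlt) N)
  · cases d with
    | zero => simp
    | succ d =>
      have : ∃ N : ModuleCat.{0} R, ¬ Subsingleton (Abelian.Ext M N (d + 1)) := by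
        by_contra! hN
        exact h' (hasProjectiveDimensionLT_of_enoughInjectives M (d + 1) hN)
      obtain ⟨N, hN⟩ := this
      rw [← subsingleton_ext_iff_subsingleton_abelianExt,
        not_subsingleton_iff_nontrivial] at hN
      exact le_sSup ⟨d + 1, N, rfl, hN⟩

open RingTheory.Sequence

/-- Vanishing of `Ext` below the length of a weakly regular sequence annihilating the source. -/
lemma subsingleton_ext_of_isWeaklyRegular {rs : List R} {N : ModuleCat.{0} R}
    (hN : ∀ r ∈ rs, ∀ y : N, r • y = 0) (M : ModuleCat.{0} R) (hM : IsWeaklyRegular M rs)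
    {j : ℕ} (hj : j < rs.length) : Subsingleton (Abelian.Ext N M j) := by
  induction rs generalizing M j with
  | nil => simp at hj
  | cons r rs ih =>
    rw [isWeaklyRegular_cons_iff] at hM
    have hr : r • 𝟙 N = 0 := by
      ext y
      exact hN r List.mem_cons_self y
    have hS := hM.1.smulShortComplex_shortExact
    refine subsingleton_of_forall_eq 0 fun e ↦ ?_
    have he : e.comp (Abelian.Ext.mk₀ (r • 𝟙 M)) (add_zero j) = 0 := by
      rw [← Abelian.Ext.smul_eq_comp_mk₀, ← Abelian.Ext.mk₀_id_comp e, ← Abelian.Ext.smul_comp,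
        ← Abelian.Ext.mk₀_smul, hr, Abelian.Ext.mk₀_zero, Abelian.Ext.zero_comp]
    cases j with
    | zero =>
      obtain ⟨f, rfl⟩ := (Abelian.Ext.mk₀_bijective _ _).2 e
      have : Mono (r • 𝟙 M) := hS.mono_f
      rw [Abelian.Ext.mk₀_comp_mk₀] at he
      have h0 := (Abelian.Ext.mk₀_bijective _ _).1 (he.trans (Abelian.Ext.mk₀_zero _ _).symm)
      rw [Limits.zero_of_comp_mono _ h0, Abelian.Ext.mk₀_zero]
    | succ j =>
      obtain ⟨e', rfl⟩ := Abelian.Ext.covariant_sequence_exact₁ _ hS e he rfl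
      have := ih (fun r hr ↦ hN r (by simp [hr])) (ModuleCat.of R (QuotSMulTop r M)) hM.2
        (Nat.lt_of_succ_lt_succ hj)
      have h0 : e' = 0 := this.elim _ _
      rw [h0]
      exact Abelian.Ext.zero_comp _ _ _ _ _

lemma subsingleton_ext_of_hasProjectiveDimensionLT {rs : List R} (hrs : IsWeaklyRegular R rs)
    {N : ModuleCat.{0} R} (hN : ∀ r ∈ rs, ∀ y : N, r • y = 0) (M : ModuleCat.{0} R) {d : ℕ}
    (hM : HasProjectiveDimensionLT M d) {j : ℕ} (hj : j + d ≤ rs.length) :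
    Subsingleton (Abelian.Ext N M j) := by
  induction d generalizing M j with
  | zero =>
    have hz := isZero_of_hasProjectiveDimensionLT_zero M
    refine subsingleton_of_forall_eq 0 fun e ↦ ?_
    rw [← Abelian.Ext.comp_mk₀_id e, hz.eq_of_src (𝟙 M) 0]
    simp
  | succ d ih =>
    cases d with
    | zero =>
      have : Projective M := projective_iff_hasProjectiveDimensionLT_one.2 hM
      have : Module.Projective R M := (IsProjective.iff_projective M).2 this
      exact subsingleton_ext_of_isWeaklyRegular hN M
        (((TensorProduct.rid R M).isWeaklyRegular_congr rs).1 hrs.isWeaklyRegular_lTensor)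
        (by omega)
    | succ d =>
      have hS := M.shortExact_projectiveShortComplex
      have hK := (hS.hasProjectiveDimensionLT_X₃_iff d inferInstance).1 hM
      have h2 : Subsingleton (Abelian.Ext N M.projectiveShortComplex.X₂ j) :=
        subsingleton_ext_of_isWeaklyRegular hN _
          (((TensorProduct.rid R _).isWeaklyRegular_congr rs).1 hrs.isWeaklyRegular_lTensor)
          (by omega)
      have h1 := ih _ hK (j := j + 1) (by omega)
      refine subsingleton_of_forall_eq 0 fun e ↦ ?_
      obtain ⟨e', rfl⟩ := Abelian.Ext.covariant_sequence_exact₃ _ hS e rfl (Subsingleton.elim _ _)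
      rw [Subsingleton.elim e' 0]
      simp

lemma eq_zero_of_hasProjectiveDimensionLT {rs : List R} (hrs : IsWeaklyRegular R rs)
    (M : Type) [AddCommGroup M] [Module R M]
    (hM : HasProjectiveDimensionLT (ModuleCat.of R M) rs.length)
    {m : M} (hm : ∀ r ∈ rs, r • m = 0) : m = 0 := by
  have := subsingleton_ext_of_hasProjectiveDimensionLT hrs
    (N := ModuleCat.of R (R ⧸ Ideal.ofList rs)) (by
      intro r hr y
      obtain ⟨y, rfl⟩ := Ideal.Quotient.mk_surjective y
      change Ideal.Quotient.mk _ (r * y) = 0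
      exact Ideal.Quotient.eq_zero_iff_mem.2
        (Ideal.mul_mem_right _ _ (Ideal.subset_span hr))) _ hM (j := 0) (by simp)
  let f : (R ⧸ Ideal.ofList rs) →ₗ[R] M := Submodule.liftQ _ (LinearMap.toSpanSingleton R M m)
    (Ideal.span_le.2 fun r hr ↦ by simpa using hm r hr)
  have hf : ModuleCat.ofHom f = 0 :=
    (Abelian.Ext.mk₀_bijective _ _).1 (Subsingleton.elim _ _)
  have h1 : f (Submodule.Quotient.mk 1) = 0 := by
    have : f = 0 := congrArg ModuleCat.Hom.hom hf
    rw [this]; rfl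
  rw [Submodule.liftQ_apply] at h1
  simpa using h1

end Homological

section Algebra

variable {R : Type} [CommRing R]

/-- The maps `R ⧸ J ⟶ R ⧸ I ⟶ R ⧸ (I ⊔ (x))`, the first one being multiplication by `x`. -/
noncomputable def quotientMulShortComplex (I J : Ideal R) (x : R) (h : ∀ f ∈ J, x * f ∈ I) :
    ShortComplex (ModuleCat.{0} R) :=
  ModuleCat.shortComplexOfCompEqZero
    (Submodule.mapQ J I (LinearMap.mulLeft R x) h)
    (Submodule.mapQ I (I ⊔ Ideal.span {x}) LinearMap.id
      (le_sup_left : I ≤ I ⊔ Ideal.span {x})) (by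
    ext
    refine (Submodule.Quotient.mk_eq_zero _).2 (Ideal.mem_sup_right ?_)
    simp)

lemma quotientMulShortComplex_shortExact (I J : Ideal R) (x : R) (h : ∀ f, f ∈ J ↔ x * f ∈ I) :
    (quotientMulShortComplex I J x fun f ↦ (h f).1).ShortExact where
  exact := by
    refine ModuleCat.shortComplex_exact _ fun y ↦ ⟨fun hy ↦ ?_, ?_⟩
    · obtain ⟨y, rfl⟩ := Submodule.Quotient.mk_surjective _ y
      have hy' : y ∈ I ⊔ Ideal.span {x} := (Submodule.Quotient.mk_eq_zero _).1 hy
      obtain ⟨a, ha, b, hb, rfl⟩ := Submodule.mem_sup.1 hy'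
      obtain ⟨c, rfl⟩ := Ideal.mem_span_singleton'.1 hb
      refine ⟨Submodule.Quotient.mk c, (Submodule.Quotient.eq _).2 ?_⟩
      have : x * c - (a + c * x) = -a := by ring
      simpa [this] using ha
    · rintro ⟨z, rfl⟩
      obtain ⟨z, rfl⟩ := Submodule.Quotient.mk_surjective _ z
      exact (Submodule.Quotient.mk_eq_zero _).2
        (Ideal.mem_sup_right (Ideal.mem_span_singleton'.2 ⟨z, mul_comm z x⟩))
  mono_f := by
    rw [ModuleCat.mono_iff_injective]
    refine (injective_iff_map_eq_zero _).2 fun y hy ↦ ?_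
    obtain ⟨y, rfl⟩ := Submodule.Quotient.mk_surjective _ y
    exact (Submodule.Quotient.mk_eq_zero _).2
      ((h y).2 ((Submodule.Quotient.mk_eq_zero _).1 hy))
  epi_g := by
    rw [ModuleCat.epi_iff_surjective]
    intro y
    obtain ⟨y, rfl⟩ := Submodule.Quotient.mk_surjective _ y
    exact ⟨Submodule.Quotient.mk y, rfl⟩

/-- The projective dimension of `R ⧸ I` is less than `n`. -/
abbrev QuotientPdLT (I : Ideal R) (n : ℕ) : Prop :=
  HasProjectiveDimensionLT (ModuleCat.of R (R ⧸ I)) n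

lemma QuotientPdLT.of_mul_mem_iff {I J : Ideal R} {x : R} {n : ℕ} (h : ∀ f, f ∈ J ↔ x * f ∈ I)
    (hJ : QuotientPdLT J n) (hI : QuotientPdLT (I ⊔ Ideal.span {x}) n) : QuotientPdLT I n :=
  (quotientMulShortComplex_shortExact I J x h).hasProjectiveDimensionLT_X₂ n hJ hI

lemma QuotientPdLT.mono {I : Ideal R} {m n : ℕ} (h : m ≤ n) (hI : QuotientPdLT I m) :
    QuotientPdLT I n :=
  hasProjectiveDimensionLT_of_ge _ m n h

lemma QuotientPdLT.sup_span_singleton {I : Ideal R} {x : R} {n : ℕ} (h : ∀ f, x * f ∈ I → f ∈ I)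
    (hI : QuotientPdLT I n) : QuotientPdLT (I ⊔ Ideal.span {x}) (n + 1) :=
  (quotientMulShortComplex_shortExact I I x
    fun f ↦ ⟨fun hf ↦ I.mul_mem_left x hf, h f⟩).hasProjectiveDimensionLT_X₃ n hI
      (hI.mono n.le_succ)

lemma QuotientPdLT.bot : QuotientPdLT (⊥ : Ideal R) 1 := by
  rw [QuotientPdLT, ← projective_iff_hasProjectiveDimensionLT_one, ← IsProjective.iff_projective]
  exact Module.Projective.of_equiv (Submodule.quotEquivOfEqBot (⊥ : Ideal R) rfl).symm

end Algebra

section Monomial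

open MvPolynomial RingTheory.Sequence

variable {K : Type} [Field K] {V : Type}

lemma mem_span_monomial_of_X_mul_mem {s : Set (V →₀ ℕ)} {v : V} (hs : ∀ t ∈ s, t v = 0)
    {f : MvPolynomial V K} (hf : X v * f ∈ Ideal.span ((fun t ↦ monomial t (1 : K)) '' s)) :
    f ∈ Ideal.span ((fun t ↦ monomial t (1 : K)) '' s) := by
  classical
  rw [mem_ideal_span_monomial_image] at hf ⊢
  intro e he
  obtain ⟨t, ht, hle⟩ := hf (Finsupp.single v 1 + e) (by
    rw [mem_support_iff, coeff_X_mul]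
    exact mem_support_iff.1 he)
  refine ⟨t, ht, fun w ↦ ?_⟩
  by_cases hw : w = v
  · subst hw
    simp [hs t ht]
  · simpa [Finsupp.single_apply, Ne.symm hw] using hle w

/-- Exponents of the products of two adjacent vertices in `W` and of the vertices in `U`. -/
def edgeExponents (G : SimpleGraph V) (W U : Set V) : Set (V →₀ ℕ) :=
  {t | ∃ u ∈ W, ∃ w ∈ W, G.Adj u w ∧ t = Finsupp.single u 1 + Finsupp.single w 1} ∪
    (fun u ↦ Finsupp.single u 1) '' U

variable (K) in
/-- The edge ideal of `G` restricted to `W`, enlarged by the variables in `U`. -/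
noncomputable def edgeVarIdeal (G : SimpleGraph V) (W U : Set V) : Ideal (MvPolynomial V K) :=
  Ideal.span ((fun t ↦ monomial t (1 : K)) '' edgeExponents G W U)

variable {G : SimpleGraph V} {W U : Set V}

lemma mem_edgeVarIdeal_of_X_mul_mem {v : V} (hW : v ∉ W) (hU : v ∉ U) {f : MvPolynomial V K}
    (hf : X v * f ∈ edgeVarIdeal K G W U) : f ∈ edgeVarIdeal K G W U := by
  classical
  refine mem_span_monomial_of_X_mul_mem ?_ hf
  rintro t (⟨u, hu, w, hw, -, rfl⟩ | ⟨u, hu, rfl⟩)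
  · have h1 : u ≠ v := fun h ↦ hW (h ▸ hu)
    have h2 : w ≠ v := fun h ↦ hW (h ▸ hw)
    simp [h1, h2]
  · have h1 : u ≠ v := fun h ↦ hU (h ▸ hu)
    simp [h1]

lemma X_mem_edgeVarIdeal {u : V} (hu : u ∈ U) : X u ∈ edgeVarIdeal K G W U :=
  Ideal.subset_span ⟨_, Or.inr ⟨u, hu, rfl⟩, rfl⟩

lemma X_mul_X_mem_edgeVarIdeal {u w : V} (hu : u ∈ W) (hw : w ∈ W) (h : G.Adj u w) :
    X u * X w ∈ edgeVarIdeal K G W U :=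
  Ideal.subset_span ⟨_, Or.inl ⟨u, hu, w, hw, h, rfl⟩, by simp [X, monomial_mul]⟩

lemma edgeVarIdeal_le_iff {I : Ideal (MvPolynomial V K)} : edgeVarIdeal K G W U ≤ I ↔
    (∀ u ∈ W, ∀ w ∈ W, G.Adj u w → X u * X w ∈ I) ∧ ∀ u ∈ U, X u ∈ I := by
  refine ⟨fun h ↦ ⟨fun u hu w hw huw ↦ h (X_mul_X_mem_edgeVarIdeal hu hw huw),
    fun u hu ↦ h (X_mem_edgeVarIdeal hu)⟩, fun ⟨h1, h2⟩ ↦ Ideal.span_le.2 ?_⟩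
  rintro _ ⟨t, ⟨u, hu, w, hw, huw, rfl⟩ | ⟨u, hu, rfl⟩, rfl⟩
  · simpa [X, monomial_mul] using h1 u hu w hw huw
  · exact h2 u hu

lemma edgeVarIdeal_insert (v : V) :
    edgeVarIdeal K G W (insert v U) = edgeVarIdeal K G W U ⊔ Ideal.span {X v} := by
  apply le_antisymm
  · rw [edgeVarIdeal_le_iff]
    refine ⟨fun u hu w hw h ↦ Ideal.mem_sup_left (X_mul_X_mem_edgeVarIdeal hu hw h), ?_⟩
    rintro u (rfl | hu)
    · exact Ideal.mem_sup_right (Ideal.mem_span_singleton_self _)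
    · exact Ideal.mem_sup_left (X_mem_edgeVarIdeal hu)
  · rw [sup_le_iff, edgeVarIdeal_le_iff, Ideal.span_singleton_le_iff_mem]
    exact ⟨⟨fun u hu w hw h ↦ X_mul_X_mem_edgeVarIdeal hu hw h,
      fun u hu ↦ X_mem_edgeVarIdeal (Set.mem_insert_of_mem _ hu)⟩,
      X_mem_edgeVarIdeal (Set.mem_insert _ _)⟩

lemma edgeVarIdeal_empty_sup_span_X {v : V} (hv : v ∈ W) :
    edgeVarIdeal K G W ∅ ⊔ Ideal.span {X v} = edgeVarIdeal K G (W \ {v}) {v} := by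
  apply le_antisymm
  · rw [sup_le_iff, edgeVarIdeal_le_iff, Ideal.span_singleton_le_iff_mem]
    have hX : X v ∈ edgeVarIdeal K G (W \ {v}) {v} := X_mem_edgeVarIdeal rfl
    refine ⟨⟨fun u hu w hw h ↦ ?_, by simp⟩, hX⟩
    by_cases huv : u = v
    · subst huv; exact Ideal.mul_mem_right _ _ hX
    by_cases hwv : w = v
    · subst hwv; exact Ideal.mul_mem_left _ _ hX
    exact X_mul_X_mem_edgeVarIdeal ⟨hu, huv⟩ ⟨hw, hwv⟩ h
  · rw [edgeVarIdeal_le_iff]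
    refine ⟨fun u hu w hw h ↦ Ideal.mem_sup_left (X_mul_X_mem_edgeVarIdeal hu.1 hw.1 h), ?_⟩
    rintro u rfl
    exact Ideal.mem_sup_right (Ideal.mem_span_singleton_self _)

/-- The colon ideal of an edge ideal by a variable. -/
lemma X_mul_mem_edgeVarIdeal_iff {v : V} (hv : v ∈ W) (f : MvPolynomial V K) :
    f ∈ edgeVarIdeal K G (W \ insert v (G.neighborSet v)) (W ∩ G.neighborSet v) ↔
      X v * f ∈ edgeVarIdeal K G W ∅ := by
  constructor
  · intro hf
    have : edgeVarIdeal K G (W \ insert v (G.neighborSet v)) (W ∩ G.neighborSet v) ≤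
        Submodule.comap (LinearMap.mulLeft (MvPolynomial V K) (X v)) (edgeVarIdeal K G W ∅) := by
      rw [edgeVarIdeal_le_iff]
      exact ⟨fun u hu w hw h ↦ show X v * (X u * X w) ∈ edgeVarIdeal K G W ∅ from
          Ideal.mul_mem_left _ _ (X_mul_X_mem_edgeVarIdeal hu.1 hw.1 h),
        fun u hu ↦ X_mul_X_mem_edgeVarIdeal hv hu.1 hu.2⟩
    exact this hf
  · intro hf
    refine mem_edgeVarIdeal_of_X_mul_mem (v := v) (by simp) (by simp) ?_
    refine (?_ : edgeVarIdeal K G W ∅ ≤ _) hf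
    rw [edgeVarIdeal_le_iff]
    refine ⟨fun u hu w hw h ↦ ?_, by simp⟩
    by_cases hu' : G.Adj v u
    · exact Ideal.mul_mem_right _ _ (X_mem_edgeVarIdeal ⟨hu, hu'⟩)
    by_cases hw' : G.Adj v w
    · exact Ideal.mul_mem_left _ _ (X_mem_edgeVarIdeal ⟨hw, hw'⟩)
    have huv : u ≠ v := by rintro rfl; exact hw' h
    have hwv : w ≠ v := by rintro rfl; exact hu' h.symm
    exact X_mul_X_mem_edgeVarIdeal ⟨hu, by simp [huv, hu']⟩ ⟨hw, by simp [hwv, hw']⟩ h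

lemma QuotientPdLT.edgeVarIdeal_of_disjoint [Finite V] {n : ℕ}
    (h : QuotientPdLT (edgeVarIdeal K G W ∅) n) (hWU : Disjoint W U) :
    QuotientPdLT (edgeVarIdeal K G W U) (n + U.ncard) := by
  induction U, U.toFinite using Set.Finite.induction_on with
  | empty => simpa using h
  | @insert u U hu _ ih =>
    rw [Set.disjoint_insert_right] at hWU
    rw [edgeVarIdeal_insert, Set.ncard_insert_of_notMem hu, ← add_assoc]
    exact (ih hWU.2).sup_span_singleton fun f ↦ mem_edgeVarIdeal_of_X_mul_mem hWU.1 hu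

lemma isWeaklyRegular_map_X {l : List V} (hl : l.Nodup) :
    IsWeaklyRegular (MvPolynomial V K) (l.map (X : V → MvPolynomial V K)) := by
  refine ⟨fun i hi ↦ ?_⟩
  have hJ : Ideal.ofList ((l.map (X : V → MvPolynomial V K)).take i) • ⊤ =
      edgeVarIdeal K (⊥ : SimpleGraph V) ∅ {v | v ∈ l.take i} := by
    rw [smul_eq_mul, Ideal.mul_top]
    apply le_antisymm
    · refine Ideal.span_le.2 fun r hr ↦ ?_
      rw [← List.map_take] at hr
      obtain ⟨v, hv, rfl⟩ := List.mem_map.1 hr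
      exact X_mem_edgeVarIdeal hv
    · rw [edgeVarIdeal_le_iff]
      refine ⟨by simp, fun u hu ↦ Ideal.subset_span ?_⟩
      rw [← List.map_take]
      exact List.mem_map_of_mem hu
  rw [hJ]
  refine isSMulRegular_iff_right_eq_zero_of_smul.2 fun y hy ↦ ?_
  obtain ⟨y, rfl⟩ := Submodule.Quotient.mk_surjective _ y
  rw [← Submodule.Quotient.mk_smul, Submodule.Quotient.mk_eq_zero, smul_eq_mul,
    List.getElem_map] at hy
  refine (Submodule.Quotient.mk_eq_zero _).2 (mem_edgeVarIdeal_of_X_mul_mem (by simp) ?_ hy)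
  intro h
  obtain ⟨j, hj, hji⟩ := List.mem_take_iff_getElem.1 h
  have := (hl.getElem_inj_iff).1 hji
  omega

lemma prod_X_notMem_edgeVarIdeal {A : Finset V} (hA : IsIndepSet G A) :
    ∏ a ∈ A, X a ∉ edgeVarIdeal K G W ∅ := by
  classical
  have hprod : ∏ a ∈ A, (X a : MvPolynomial V K) =
      monomial (∑ a ∈ A, Finsupp.single a 1) 1 := by
    rw [monomial_sum_one]
    rfl
  rw [hprod, edgeVarIdeal, mem_ideal_span_monomial_image]
  intro h
  obtain ⟨t, ht, hle⟩ := h _ (by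
    rw [mem_support_iff, coeff_monomial, if_pos rfl]
    exact one_ne_zero)
  obtain ⟨u, -, w, -, huw, rfl⟩ | ⟨u, hu, -⟩ := ht
  · have hmem : ∀ z, 1 ≤ (Finsupp.single u 1 + Finsupp.single w 1 : V →₀ ℕ) z → z ∈ A := by
      intro z hz
      have := hz.trans (hle z)
      by_contra hzA
      simp [Finsupp.finsetSum_apply, Finsupp.single_apply, hzA] at this
    exact hA u (hmem u (by simp)) w (hmem w (by simp)) huw
  · exact hu

lemma not_quotientPdLT_edgeVarIdeal_univ [Finite V] {A : Set V} (hdom : IsDominatingSet G A)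
    (hind : IsIndepSet G A) :
    ¬ QuotientPdLT (edgeVarIdeal K G Set.univ ∅) (Nat.card V - A.ncard) := by
  classical
  have := Fintype.ofFinite V
  intro h
  let l : List V := A.toFinsetᶜ.toList
  have hl : (l.map (X : V → MvPolynomial V K)).length = Nat.card V - A.ncard := by
    simp [l, Finset.card_compl, Set.ncard_eq_toFinset_card']
  rw [← hl] at h
  have h0 := eq_zero_of_hasProjectiveDimensionLT
    (isWeaklyRegular_map_X (K := K) A.toFinsetᶜ.nodup_toList) _ h
    (m := Submodule.Quotient.mk (∏ a ∈ A.toFinset, X a)) (by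
      intro r hr
      obtain ⟨v, hv, rfl⟩ := List.mem_map.1 hr
      obtain ⟨a, ha, hva⟩ := hdom v (by simpa [l] using hv)
      rw [← Submodule.Quotient.mk_smul, Submodule.Quotient.mk_eq_zero, smul_eq_mul,
        ← Finset.mul_prod_erase _ _ (Set.mem_toFinset.2 ha), ← mul_assoc]
      exact Ideal.mul_mem_right _ _ (X_mul_X_mem_edgeVarIdeal trivial trivial hva))
  rw [Submodule.Quotient.mk_eq_zero] at h0
  exact prod_X_notMem_edgeVarIdeal (by simpa using hind) h0

lemma edgeIdeal_eq_edgeVarIdeal_univ : edgeIdeal K G = edgeVarIdeal K G Set.univ ∅ := by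
  apply le_antisymm
  · refine Ideal.span_le.2 ?_
    rintro _ ⟨u, v, h, rfl⟩
    exact X_mul_X_mem_edgeVarIdeal trivial trivial h
  · rw [edgeVarIdeal_le_iff]
    exact ⟨fun u _ w _ h ↦ Ideal.subset_span ⟨u, w, h, rfl⟩, by simp⟩

end Monomial

section IndependentDomination

variable {V : Type} {G : SimpleGraph V} {W : Set V}

/-- The independent domination number of the subgraph of `G` induced on `W`. -/
noncomputable def indDomNumOn (G : SimpleGraph V) (W : Set V) : ℕ :=
  sInf {n | ∃ A ⊆ W, (∀ v ∈ W, v ∉ A → ∃ a ∈ A, G.Adj v a) ∧ IsIndepSet G A ∧ A.ncard = n}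

lemma exists_ncard_eq_indDomNumOn [Finite V] (G : SimpleGraph V) (W : Set V) :
    ∃ A ⊆ W, (∀ v ∈ W, v ∉ A → ∃ a ∈ A, G.Adj v a) ∧ IsIndepSet G A ∧
      A.ncard = indDomNumOn G W := by
  suffices h : {n | ∃ A ⊆ W, (∀ v ∈ W, v ∉ A → ∃ a ∈ A, G.Adj v a) ∧ IsIndepSet G A ∧
      A.ncard = n}.Nonempty from Nat.sInf_mem h
  obtain ⟨A, hA⟩ := (Set.toFinite {A : Set V | A ⊆ W ∧ IsIndepSet G A}).exists_maximal
    ⟨∅, Set.empty_subset _, by simp [IsIndepSet]⟩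
  refine ⟨A.ncard, A, hA.prop.1, fun v hv hvA ↦ ?_, hA.prop.2, rfl⟩
  by_contra! hno
  refine hvA (hA.le_of_ge (y := insert v A) ⟨Set.insert_subset hv hA.prop.1, ?_⟩
    (Set.subset_insert v A) (Set.mem_insert v A))
  rintro x (rfl | hx) y (rfl | hy)
  · exact G.irrefl
  · exact hno y hy
  · exact fun h ↦ hno x hx h.symm
  · exact hA.prop.2 x hx y hy

lemma indDomNumOn_le_ncard [Finite V] (G : SimpleGraph V) (W : Set V) :
    indDomNumOn G W ≤ W.ncard := by
  obtain ⟨A, hAW, -, -, hA⟩ := exists_ncard_eq_indDomNumOn G W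
  exact hA ▸ Set.ncard_le_ncard hAW

lemma indDomNumOn_le_sdiff_add_one [Finite V] {v : V} (hv : v ∈ W) :
    indDomNumOn G W ≤ indDomNumOn G (W \ insert v (G.neighborSet v)) + 1 := by
  obtain ⟨A, hAW, hdom, hind, hA⟩ :=
    exists_ncard_eq_indDomNumOn G (W \ insert v (G.neighborSet v))
  have hnadj : ∀ a ∈ A, ¬ G.Adj v a := fun a ha h ↦ (hAW ha).2 (Or.inr h)
  have hvA : v ∉ A := fun h ↦ (hAW h).2 (Or.inl rfl)
  rw [← hA, ← Set.ncard_insert_of_notMem hvA]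
  refine Nat.sInf_le ⟨insert v A, Set.insert_subset hv fun a ha ↦ (hAW ha).1, ?_, ?_, rfl⟩
  · intro w hw hwA
    by_cases hvw : G.Adj v w
    · exact ⟨v, Set.mem_insert _ _, hvw.symm⟩
    · obtain ⟨a, ha, hwa⟩ := hdom w ⟨hw, by
        rintro (rfl | h)
        · exact hwA (Set.mem_insert _ _)
        · exact hvw h⟩ fun h ↦ hwA (Set.mem_insert_of_mem _ h)
      exact ⟨a, Set.mem_insert_of_mem _ ha, hwa⟩
  · rintro x (rfl | hx) y (rfl | hy)
    · exact G.irrefl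
    · exact hnadj y hy
    · exact fun h ↦ hnadj x hx h.symm
    · exact hind x hx y hy

lemma indDomNum_eq_indDomNumOn_range {V' : Type} {H : SimpleGraph V'} (f : H ↪g G) :
    indDomNum H = indDomNumOn G (Set.range f) := by
  unfold indDomNum indDomNumOn
  congr 1
  ext n
  constructor
  · rintro ⟨A, hdom, hind, rfl⟩
    refine ⟨f '' A, Set.image_subset_range _ _, ?_, ?_, Set.ncard_image_of_injective _ f.injective⟩
    · rintro _ ⟨v, rfl⟩ hv
      obtain ⟨a, ha, hva⟩ := hdom v fun h ↦ hv (Set.mem_image_of_mem _ h)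
      exact ⟨f a, Set.mem_image_of_mem _ ha, f.map_adj_iff.2 hva⟩
    · rintro _ ⟨x, hx, rfl⟩ _ ⟨y, hy, rfl⟩ h
      exact hind x hx y hy (f.map_adj_iff.1 h)
  · rintro ⟨A, hA, hdom, hind, rfl⟩
    obtain ⟨A, rfl⟩ := Set.subset_range_iff_exists_image_eq.1 hA
    refine ⟨A, fun v hv ↦ ?_, fun x hx y hy h ↦ ?_,
      (Set.ncard_image_of_injective _ f.injective).symm⟩
    · obtain ⟨_, ⟨a, ha, rfl⟩, hva⟩ := hdom (f v) ⟨v, rfl⟩ (by simpa using hv)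
      exact ⟨a, ha, f.map_adj_iff.1 hva⟩
    · exact hind _ (Set.mem_image_of_mem _ hx) _ (Set.mem_image_of_mem _ hy) (f.map_adj_iff.2 h)

lemma indDomNumOn_univ : indDomNumOn G Set.univ = indDomNum G := by
  rw [indDomNum_eq_indDomNumOn_range (SimpleGraph.Embedding.refl (G := G))]
  exact congrArg _ Set.range_id.symm

end IndependentDomination

section Class

variable {V : Type} {G : SimpleGraph V} {W : Set V}
  {C : ∀ (V : Type) [Finite V], SimpleGraph V → Prop}

/-- The subgraph of `G` induced on `W` is isomorphic to a member of the class `C`. -/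
def InducedMem (C : ∀ (V : Type) [Finite V], SimpleGraph V → Prop) (G : SimpleGraph V)
    (W : Set V) : Prop :=
  ∃ (V' : Type) (_ : Finite V') (H : SimpleGraph V') (f : H ↪g G), C V' H ∧ Set.range f = W

lemma range_comp_induce_compl_singleton {V' : Type} {H : SimpleGraph V'} (f : H ↪g G) (v : V') :
    Set.range (f.comp (SimpleGraph.Embedding.induce ({v}ᶜ : Set V'))) = Set.range f \ {f v} := by
  ext x
  constructor
  · rintro ⟨⟨y, hy⟩, rfl⟩
    exact ⟨⟨y, rfl⟩, fun h ↦ hy (f.injective h)⟩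
  · rintro ⟨⟨y, rfl⟩, hy⟩
    exact ⟨⟨y, fun h ↦ hy (congrArg f h)⟩, rfl⟩

lemma InducedMem.sdiff_singleton
    (hered : ∀ (V : Type) [Finite V] (G : SimpleGraph V), C V G →
      ∀ v : V, C ({v}ᶜ : Set V) (G.induce {v}ᶜ))
    (hW : InducedMem C G W) (v : V) : InducedMem C G (W \ {v}) := by
  obtain ⟨V', _, H, f, hC, rfl⟩ := hW
  by_cases hv : v ∈ Set.range f
  · obtain ⟨v, rfl⟩ := hv
    exact ⟨_, inferInstance, _, _, hered V' H hC v, range_comp_induce_compl_singleton f v⟩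
  · rw [Set.sdiff_singleton_eq_self hv]
    exact ⟨V', _, H, f, hC, rfl⟩

lemma InducedMem.sdiff [Finite V]
    (hered : ∀ (V : Type) [Finite V] (G : SimpleGraph V), C V G →
      ∀ v : V, C ({v}ᶜ : Set V) (G.induce {v}ᶜ))
    (hW : InducedMem C G W) (U : Set V) : InducedMem C G (W \ U) := by
  induction U, U.toFinite using Set.Finite.induction_on with
  | empty => simpa using hW
  | @insert u U _ _ ih =>
    have : W \ insert u U = (W \ U) \ {u} := by
      rw [Set.sdiff_sdiff, Set.union_singleton]
    exact this ▸ ih.sdiff_singleton hered u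

lemma InducedMem.exists_indDomNumOn_le
    (hcond : ∀ (V : Type) [Finite V] (G : SimpleGraph V), C V G → (∃ u v : V, G.Adj u v) →
      ∃ v : V, indDomNum G ≤ indDomNum (G.induce ({v}ᶜ : Set V)))
    (hW : InducedMem C G W) (hadj : ∃ u ∈ W, ∃ w ∈ W, G.Adj u w) :
    ∃ v ∈ W, indDomNumOn G W ≤ indDomNumOn G (W \ {v}) := by
  obtain ⟨V', _, H, f, hC, rfl⟩ := hW
  obtain ⟨_, ⟨u, rfl⟩, _, ⟨w, rfl⟩, huw⟩ := hadj
  obtain ⟨v, hv⟩ := hcond V' H hC ⟨u, w, f.map_adj_iff.1 huw⟩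
  refine ⟨f v, ⟨v, rfl⟩, ?_⟩
  rwa [← range_comp_induce_compl_singleton, ← indDomNum_eq_indDomNumOn_range,
    ← indDomNum_eq_indDomNumOn_range]

lemma InducedMem.quotientPdLT_edgeVarIdeal (K : Type) [Field K] [Finite V]
    (hered : ∀ (V : Type) [Finite V] (G : SimpleGraph V), C V G →
      ∀ v : V, C ({v}ᶜ : Set V) (G.induce {v}ᶜ))
    (hcond : ∀ (V : Type) [Finite V] (G : SimpleGraph V), C V G → (∃ u v : V, G.Adj u v) →
      ∃ v : V, indDomNum G ≤ indDomNum (G.induce ({v}ᶜ : Set V)))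
    (hW : InducedMem C G W) :
    QuotientPdLT (edgeVarIdeal K G W ∅) (W.ncard - indDomNumOn G W + 1) := by
  induction hn : W.ncard using Nat.strong_induction_on generalizing W with
  | _ n ih =>
  subst hn
  by_cases hadj : ∃ u ∈ W, ∃ w ∈ W, G.Adj u w
  · obtain ⟨v, hv, hle⟩ := hW.exists_indDomNumOn_le hcond hadj
    have hcard : (W \ {v}).ncard + 1 = W.ncard := Set.ncard_sdiff_singleton_add_one hv
    set N := W ∩ G.neighborSet v
    set W' := W \ insert v (G.neighborSet v)
    have hcard' : W'.ncard + N.ncard + 1 = W.ncard := by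
      have hW' : W' = (W \ {v}) \ N := by
        ext x
        simp only [W', N, Set.mem_sdiff, Set.mem_insert_iff, Set.mem_inter_iff,
          Set.mem_singleton_iff]
        tauto
      have hN : N ⊆ W \ {v} := fun x hx ↦ ⟨hx.1, by rintro rfl; exact G.irrefl hx.2⟩
      rw [hW', Set.ncard_sdiff_add_ncard_of_subset hN, hcard]
    refine QuotientPdLT.of_mul_mem_iff (X_mul_mem_edgeVarIdeal_iff hv) ?_ ?_
    · have hdisj : Disjoint W' N :=
        Set.disjoint_left.2 fun x hx hxN ↦ hx.2 (Or.inr hxN.2)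
      have hW' : InducedMem C G W' := hW.sdiff hered _
      refine ((ih _ (by omega) hW' rfl).edgeVarIdeal_of_disjoint hdisj).mono ?_
      have h1 : indDomNumOn G W ≤ indDomNumOn G W' + 1 := indDomNumOn_le_sdiff_add_one hv
      have h2 := indDomNumOn_le_ncard G W'
      omega
    · rw [edgeVarIdeal_empty_sup_span_X hv]
      refine ((ih _ (by omega) (hW.sdiff_singleton hered v) rfl).edgeVarIdeal_of_disjoint
        Set.disjoint_sdiff_left).mono ?_
      have h2 := indDomNumOn_le_ncard G (W \ {v})
      rw [Set.ncard_singleton]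
      omega
  · have hbot : edgeVarIdeal K G W ∅ = ⊥ := by
      rw [← le_bot_iff, edgeVarIdeal_le_iff]
      exact ⟨fun u hu w hw h ↦ (hadj ⟨u, hu, w, hw, h⟩).elim, by simp⟩
    rw [hbot]
    exact QuotientPdLT.bot.mono (by omega)

end Class

/-- pd(G) = n - i(G), stated as pd(G) + i(G) = n. -/
theorem stmt15 (K : Type) [Field K]
    (C : ∀ (V : Type) [Finite V], SimpleGraph V → Prop)
    (hered : ∀ (V : Type) [Finite V] (G : SimpleGraph V), C V G →
      ∀ v : V, C ({v}ᶜ : Set V) (G.induce {v}ᶜ))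
    (hcond : ∀ (V : Type) [Finite V] (G : SimpleGraph V), C V G → (∃ u v : V, G.Adj u v) →
      ∃ v : V, indDomNum G ≤ indDomNum (G.induce ({v}ᶜ : Set V))) :
    ∀ (V : Type) [Finite V] (G : SimpleGraph V), C V G →
      graphPd K G + (indDomNum G : ℕ∞) = (Nat.card V : ℕ∞) := by
  intro V _ G hG
  have hmem : InducedMem C G Set.univ :=
    ⟨V, inferInstance, G, SimpleGraph.Embedding.refl, hG, Set.range_id⟩
  have hup := hmem.quotientPdLT_edgeVarIdeal K hered hcond
  have hle := indDomNumOn_le_ncard G Set.univ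
  obtain ⟨A, -, hdom, hind, hA⟩ := exists_ncard_eq_indDomNumOn G Set.univ
  have hlow := not_quotientPdLT_edgeVarIdeal_univ (K := K) (fun v hv ↦ hdom v trivial hv) hind
  rw [hA] at hlow
  rw [Set.ncard_univ] at hup hle
  rw [indDomNumOn_univ] at hup hlow hle
  rw [← edgeIdeal_eq_edgeVarIdeal_univ] at hup hlow
  rw [graphPd, projDim_eq_of_hasProjectiveDimensionLT hup hlow, ← Nat.cast_add,
    Nat.sub_add_cancel hle]
end

section
/- Let G be a chordal finite simple graph on n vertices. Then pd(G) = n − i(G). -/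
open CategoryTheory
open scoped ENNReal

/-- A cycle has a chord if some edge of the graph joins two vertices of the cycle
but is not an edge of the cycle (i.e. joins two non-consecutive vertices). -/
def HasChord {V : Type} (G : SimpleGraph V) {v : V} (c : G.Walk v v) : Prop :=
  ∃ u w : V, u ∈ c.support ∧ w ∈ c.support ∧ G.Adj u w ∧ s(u, w) ∉ c.edges

/-- A graph is chordal if every cycle of length at least 4 has a chord. -/
def IsChordal {V : Type} (G : SimpleGraph V) : Prop :=
  ∀ (v : V) (c : G.Walk v v), c.IsCycle → 4 ≤ c.length → HasChord G c

lemma subsingleton_derivedExt_succ_iff {R : Type} [CommRing R] (M N : ModuleCat.{0} R) (i : ℕ) :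
    Subsingleton (((Ext R (ModuleCat R) (i + 1)).obj (Opposite.op M)).obj N) ↔
      Subsingleton (Abelian.Ext.{0} M N (i + 1)) := by
  let P := ProjectiveResolution.of M
  rw [(P.isoExt (R := R) (i + 1) N).toLinearEquiv.toEquiv.subsingleton_congr,
    ← ModuleCat.isZero_iff_subsingleton, ← HomologicalComplex.exactAt_iff_isZero_homology,
    HomologicalComplex.exactAt_iff' _ i (i + 1) (i + 2) (by simp) (by simp),
    ShortComplex.moduleCat_exact_iff]
  constructor
  · intro h
    refine subsingleton_of_forall_eq 0 fun e ↦ ?_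
    obtain ⟨f, hf, rfl⟩ := P.extMk_surjective e (i + 2) rfl
    rw [P.extMk_eq_zero_iff f _ rfl hf i rfl]
    exact h f hf
  · intro h f hf
    exact (P.extMk_eq_zero_iff f _ rfl hf i rfl).1 (Subsingleton.elim _ _)

lemma shortExact_quotient_colon {R : Type} [CommRing R] (a : R) (I J L : Ideal R)
    (hJ : ∀ f, f ∈ J ↔ a * f ∈ I) (hL : L = I ⊔ Ideal.span {a}) :
    ∃ (f : ModuleCat.of R (R ⧸ J) ⟶ ModuleCat.of R (R ⧸ I))
      (g : ModuleCat.of R (R ⧸ I) ⟶ ModuleCat.of R (R ⧸ L)) (w : f ≫ g = 0),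
      (ShortComplex.mk f g w).ShortExact ∧
        ∀ q : R, f (Submodule.Quotient.mk q) = Submodule.Quotient.mk (a * q) := by
  have hIL : I ≤ L := hL ▸ le_sup_left
  let φ : (R ⧸ J) →ₗ[R] (R ⧸ I) := Submodule.mapQ J I (LinearMap.mulLeft R a) fun f hf ↦ (hJ f).1 hf
  let ψ : (R ⧸ I) →ₗ[R] (R ⧸ L) := Submodule.mapQ I L LinearMap.id hIL
  have hφ : Function.Injective φ := by
    rw [injective_iff_map_eq_zero]
    intro x hx
    obtain ⟨x, rfl⟩ := Submodule.Quotient.mk_surjective _ x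
    rw [Submodule.Quotient.mk_eq_zero, hJ]
    exact (Submodule.Quotient.mk_eq_zero _).1 hx
  have hψ : Function.Surjective ψ := by
    intro x
    obtain ⟨x, rfl⟩ := Submodule.Quotient.mk_surjective _ x
    exact ⟨Submodule.Quotient.mk x, rfl⟩
  have hex : Function.Exact φ ψ := by
    intro y
    obtain ⟨y, rfl⟩ := Submodule.Quotient.mk_surjective _ y
    change Submodule.Quotient.mk y = 0 ↔ _
    rw [Submodule.Quotient.mk_eq_zero, hL, Submodule.mem_sup]
    constructor
    · rintro ⟨u, hu, v, hv, rfl⟩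
      obtain ⟨b, rfl⟩ := Ideal.mem_span_singleton'.1 hv
      refine ⟨Submodule.Quotient.mk b, ?_⟩
      change Submodule.Quotient.mk (a * b) = _
      rw [Submodule.Quotient.eq, mul_comm]
      simpa using hu
    · rintro ⟨b, hb⟩
      obtain ⟨b, rfl⟩ := Submodule.Quotient.mk_surjective _ b
      change Submodule.Quotient.mk (a * b) = _ at hb
      rw [eq_comm, Submodule.Quotient.eq] at hb
      exact ⟨_, hb, a * b, Ideal.mul_mem_right _ _ (Ideal.mem_span_singleton_self a), by ring⟩
  refine ⟨ModuleCat.ofHom φ, ModuleCat.ofHom ψ, ?_, ?_, fun _ ↦ rfl⟩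
  · exact ModuleCat.hom_ext (LinearMap.ext fun x ↦ (hex _).2 ⟨x, rfl⟩)
  · exact ModuleCat.shortComplex_shortExact _ hex hφ hψ

lemma shortExact_quotient_smul {R : Type} [CommRing R] (a : R) (I L : Ideal R)
    (hI : ∀ f, f ∈ I ↔ a * f ∈ I) (hL : L = I ⊔ Ideal.span {a}) :
    ∃ (g : ModuleCat.of R (R ⧸ I) ⟶ ModuleCat.of R (R ⧸ L))
      (w : (a • 𝟙 (ModuleCat.of R (R ⧸ I))) ≫ g = 0),
      (ShortComplex.mk (a • 𝟙 (ModuleCat.of R (R ⧸ I))) g w).ShortExact := by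
  obtain ⟨f, g, w, hS, hf⟩ := shortExact_quotient_colon a I I L hI hL
  obtain rfl : f = a • 𝟙 (ModuleCat.of R (R ⧸ I)) := by
    refine ModuleCat.hom_ext (LinearMap.ext fun q ↦ ?_)
    obtain ⟨q, rfl⟩ := Submodule.Quotient.mk_surjective _ q
    exact hf q
  exact ⟨g, w, hS⟩

lemma ext_smul_eq_of_left {R : Type} [CommRing R] {M N : ModuleCat.{0} R} {i : ℕ} (a c : R)
    (h : ∀ m : M, a • m = c • m) (e : Abelian.Ext.{0} M N i) : a • e = c • e := by
  have : a • 𝟙 M = c • 𝟙 M := by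
    ext m
    exact h m
  rw [← Abelian.Ext.mk₀_id_comp e, ← Abelian.Ext.smul_comp, ← Abelian.Ext.smul_comp,
    ← Abelian.Ext.mk₀_smul, ← Abelian.Ext.mk₀_smul, this]

lemma ext_smul_eq_of_right {R : Type} [CommRing R] {M N : ModuleCat.{0} R} {i : ℕ} (a c : R)
    (h : ∀ n : N, a • n = c • n) (e : Abelian.Ext.{0} M N i) : a • e = c • e := by
  have : a • 𝟙 N = c • 𝟙 N := by
    ext n
    exact h n
  rw [Abelian.Ext.smul_eq_comp_mk₀, Abelian.Ext.smul_eq_comp_mk₀, this]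

/-- The ideal of polynomials all of whose monomials have support either leaving `W` or
containing an edge of `G`. -/
noncomputable def indepIdeal (K : Type) [Field K] {V : Type} (G : SimpleGraph V) (W : Finset V) :
    Ideal (MvPolynomial V K) :=
  Ideal.span ((fun m ↦ MvPolynomial.monomial m (1 : K)) ''
    {m | ¬ (m.support ⊆ W ∧ IsIndepSet G m.support)})

lemma mem_indepIdeal {K : Type} [Field K] {V : Type} {G : SimpleGraph V} {W : Finset V}
    {f : MvPolynomial V K} :
    f ∈ indepIdeal K G W ↔ ∀ m ∈ f.support, ¬ (m.support ⊆ W ∧ IsIndepSet G m.support) := by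
  rw [indepIdeal, MvPolynomial.mem_ideal_span_monomial_image]
  refine forall₂_congr fun m _ ↦ ⟨?_, fun h ↦ ⟨m, h, le_rfl⟩⟩
  rintro ⟨s, hs, hsm⟩ ⟨hW, hm⟩
  have hsub : s.support ⊆ m.support := Finsupp.support_mono hsm
  exact hs ⟨hsub.trans hW, fun u hu v hv ↦ hm u (hsub hu) v (hsub hv)⟩

lemma indepIdeal_univ (K : Type) [Field K] {V : Type} [Fintype V] (G : SimpleGraph V) :
    indepIdeal K G Finset.univ = edgeIdeal K G := by
  classical
  have : {p : MvPolynomial V K | ∃ u v, G.Adj u v ∧ p = MvPolynomial.X u * MvPolynomial.X v} =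
      (fun m ↦ MvPolynomial.monomial m (1 : K)) ''
        {m | ∃ u v, G.Adj u v ∧ m = Finsupp.single u 1 + Finsupp.single v 1} := by
    ext p
    constructor
    · rintro ⟨u, v, h, rfl⟩
      exact ⟨_, ⟨u, v, h, rfl⟩, by simp [MvPolynomial.X, MvPolynomial.monomial_mul]⟩
    · rintro ⟨_, ⟨u, v, h, rfl⟩, rfl⟩
      exact ⟨u, v, h, by simp [MvPolynomial.X, MvPolynomial.monomial_mul]⟩
  ext f
  rw [mem_indepIdeal, edgeIdeal, this, MvPolynomial.mem_ideal_span_monomial_image]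
  refine forall₂_congr fun m _ ↦ ?_
  simp only [IsIndepSet, Finset.subset_univ, true_and, not_forall, not_not]
  constructor
  · rintro ⟨u, hu, v, hv, h⟩
    refine ⟨_, ⟨u, v, h, rfl⟩, fun w ↦ ?_⟩
    have hu' : m u ≠ 0 := by simpa using hu
    have hv' : m v ≠ 0 := by simpa using hv
    have := h.ne
    simp only [Finsupp.add_apply, Finsupp.single_apply]
    split_ifs <;> simp_all <;> omega
  · rintro ⟨_, ⟨u, v, h, rfl⟩, hm⟩
    have hu := hm u
    have hv := hm v
    simp only [Finsupp.add_apply, Finsupp.single_apply] at hu hv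
    refine ⟨u, ?_, v, ?_, h⟩
    · simp; rintro h0; simp [h0] at hu
    · simp; rintro h0; simp [h0] at hv

open Classical in
lemma X_mul_mem_indepIdeal {K : Type} [Field K] {V : Type} {G : SimpleGraph V} {W : Finset V}
    {x : V} (hx : x ∈ W) (f : MvPolynomial V K) :
    f ∈ indepIdeal K G (W.filter fun y ↦ ¬ G.Adj x y) ↔
      MvPolynomial.X x * f ∈ indepIdeal K G W := by
  rw [mem_indepIdeal, mem_indepIdeal, MvPolynomial.support_X_mul]
  simp only [Finset.mem_map, addLeftEmbedding_apply, forall_exists_index, and_imp,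
    forall_apply_eq_imp_iff₂]
  refine forall₂_congr fun m _ ↦ not_congr ?_
  have hs : (Finsupp.single x 1 + m).support = insert x m.support := by
    ext y
    by_cases h : y = x <;> simp [h, Ne.symm]
  rw [hs]
  rw [Finset.insert_subset_iff]
  simp only [IsIndepSet, Finset.coe_insert, Set.forall_mem_insert, hx,
    true_and, G.irrefl, not_false_eq_true, Finset.mem_coe, Finset.subset_iff, Finset.mem_filter]
  constructor
  · rintro ⟨h1, h2⟩
    exact ⟨fun y hy ↦ (h1 hy).1, fun y hy ↦ (h1 hy).2,
      fun y hy ↦ ⟨fun h ↦ (h1 hy).2 h.symm, h2 y hy⟩⟩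
  · rintro ⟨h1, h2, h3⟩
    exact ⟨fun y hy ↦ ⟨h1 hy, h2 y hy⟩, fun y hy ↦ (h3 y hy).2⟩

lemma indepIdeal_erase {K : Type} [Field K] {V : Type} [DecidableEq V] (G : SimpleGraph V)
    (W : Finset V) (x : V) :
    indepIdeal K G (W.erase x) = indepIdeal K G W ⊔ Ideal.span {MvPolynomial.X x} := by
  have : ({MvPolynomial.X x} : Set (MvPolynomial V K)) =
      (fun m ↦ MvPolynomial.monomial m (1 : K)) '' {Finsupp.single x 1} := by
    simp [MvPolynomial.X]
  ext f
  rw [mem_indepIdeal, indepIdeal, this, ← Ideal.span_union, ← Set.image_union,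
    MvPolynomial.mem_ideal_span_monomial_image]
  refine forall₂_congr fun m _ ↦ ?_
  constructor
  · intro h
    by_cases hm : m.support ⊆ W ∧ IsIndepSet G m.support
    · refine ⟨Finsupp.single x 1, Or.inr rfl, ?_⟩
      by_contra hx
      refine h ⟨Finset.subset_erase.2 ⟨hm.1, fun h' ↦ hx ?_⟩, hm.2⟩
      rw [Finsupp.single_le_iff]
      exact Nat.one_le_iff_ne_zero.2 (by simpa using h')
    · exact ⟨m, Or.inl hm, le_rfl⟩
  · rintro ⟨s, hs, hsm⟩ ⟨h1, h2⟩
    have hsub : s.support ⊆ m.support := Finsupp.support_mono hsm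
    rcases hs with hs | rfl
    · exact hs ⟨(hsub.trans h1).trans (Finset.erase_subset _ _),
        fun u hu v hv ↦ h2 u (hsub hu) v (hsub hv)⟩
    · exact (Finset.subset_erase.1 h1).2 (hsub (by simp))

/-- The quotient of the polynomial ring by `indepIdeal`. -/
noncomputable abbrev indepQuotient (K : Type) [Field K] {V : Type} (G : SimpleGraph V)
    (W : Finset V) : ModuleCat (MvPolynomial V K) :=
  ModuleCat.of (MvPolynomial V K) (MvPolynomial V K ⧸ indepIdeal K G W)

open Classical in
lemma exists_shortExact_indepQuotient (K : Type) [Field K] {V : Type} (G : SimpleGraph V)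
    {W : Finset V} {x : V} (hx : x ∈ W) :
    ∃ (f : indepQuotient K G (W.filter fun y ↦ ¬ G.Adj x y) ⟶ indepQuotient K G W)
      (g : indepQuotient K G W ⟶ indepQuotient K G (W.erase x)) (w : f ≫ g = 0),
      (ShortComplex.mk f g w).ShortExact := by
  obtain ⟨f, g, w, hS, -⟩ := shortExact_quotient_colon (MvPolynomial.X x) _ _ _
    (X_mul_mem_indepIdeal (K := K) (G := G) hx) (indepIdeal_erase G W x)
  exact ⟨f, g, w, hS⟩

lemma exists_shortExact_indepQuotient_bot (K : Type) [Field K] {V : Type} [DecidableEq V]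
    {W : Finset V} {x : V} (hx : x ∉ W) :
    ∃ (g : indepQuotient K (⊥ : SimpleGraph V) (insert x W) ⟶ indepQuotient K ⊥ W)
      (w : ((MvPolynomial.X x : MvPolynomial V K) • 𝟙 (indepQuotient K ⊥ (insert x W))) ≫ g = 0),
      (ShortComplex.mk _ g w).ShortExact := by
  refine shortExact_quotient_smul _ _ _ (fun f ↦ ?_) ?_
  · convert X_mul_mem_indepIdeal (K := K) (G := ⊥) (Finset.mem_insert_self x W) f
    simp
  · rw [← indepIdeal_erase, Finset.erase_insert hx]

lemma indepIdeal_eq_of_isIndepSet (K : Type) [Field K] {V : Type} {G : SimpleGraph V}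
    {W : Finset V} (hW : IsIndepSet G W) : indepIdeal K G W = indepIdeal K ⊥ W := by
  ext f
  simp only [mem_indepIdeal]
  refine forall₂_congr fun m _ ↦ not_congr (and_congr_right fun h ↦ ?_)
  exact iff_of_true (fun u hu v hv ↦ hW u (h hu) v (h hv)) fun _ _ _ _ h ↦ h

lemma indepIdeal_bot_univ (K : Type) [Field K] (V : Type) [Fintype V] :
    indepIdeal K (⊥ : SimpleGraph V) Finset.univ = ⊥ := by
  simp [indepIdeal, IsIndepSet]

lemma hasProjectiveDimensionLT_indepQuotient_bot (K : Type) [Field K] {V : Type} [Fintype V]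
    (W : Finset V) :
    HasProjectiveDimensionLT (indepQuotient K (⊥ : SimpleGraph V) W)
      (Fintype.card V - W.card + 1) := by
  classical
  induction h : Fintype.card V - W.card generalizing W with
  | zero =>
    have hW : W = Finset.univ :=
      Finset.eq_univ_of_card W (le_antisymm (Finset.card_le_univ W) (by omega))
    subst hW
    rw [indepQuotient, indepIdeal_bot_univ]
    have : Module.Projective (MvPolynomial V K) (MvPolynomial V K ⧸ (⊥ : Ideal (MvPolynomial V K))) :=
      Module.Projective.of_equiv
        (Submodule.quotEquivOfEqBot (⊥ : Ideal (MvPolynomial V K)) rfl).symm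
    infer_instance
  | succ n ih =>
    obtain ⟨x, hx⟩ : ∃ x, x ∉ W := by
      by_contra! h'
      rw [Finset.eq_univ_of_forall h', Finset.card_univ] at h
      omega
    obtain ⟨g, w, hS⟩ := exists_shortExact_indepQuotient_bot K hx
    have := ih (insert x W) (by rw [Finset.card_insert_of_notMem hx]; omega)
    exact hS.hasProjectiveDimensionLT_X₃ (n + 1) this
      (hasProjectiveDimensionLT_of_ge _ (n + 1) _ (by omega))

/-- The residue module of the point with coordinates `1` on `F` and `0` elsewhere. -/
noncomputable def pointModule (K : Type) [Field K] {V : Type} (F : Finset V) :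
    ModuleCat (MvPolynomial V K) :=
  ModuleCat.of _ (MvPolynomial V K ⧸
    RingHom.ker (MvPolynomial.eval ((F : Set V).indicator (1 : V → K))))

lemma X_smul_pointModule (K : Type) [Field K] {V : Type} (F : Finset V) (x : V)
    (n : pointModule K F) :
    (MvPolynomial.X x : MvPolynomial V K) • n =
      (MvPolynomial.C ((F : Set V).indicator 1 x) : MvPolynomial V K) • n := by
  obtain ⟨n, rfl⟩ := Submodule.Quotient.mk_surjective _ n
  refine (Submodule.Quotient.eq _).2 ?_
  simp [RingHom.mem_ker]

lemma X_smul_ext_pointModule {K : Type} [Field K] {V : Type} {F : Finset V} {x : V}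
    {M : ModuleCat (MvPolynomial V K)} {i : ℕ} (e : Abelian.Ext.{0} M (pointModule K F) i) :
    (MvPolynomial.X x : MvPolynomial V K) • e =
      (MvPolynomial.C ((F : Set V).indicator 1 x) : MvPolynomial V K) • e :=
  ext_smul_eq_of_right _ _ (X_smul_pointModule K F x) e

lemma X_smul_indepQuotient_eq_zero {K : Type} [Field K] {V : Type} {G : SimpleGraph V}
    {W : Finset V} {x : V} (hx : x ∉ W) (n : indepQuotient K G W) :
    (MvPolynomial.X x : MvPolynomial V K) • n = (0 : MvPolynomial V K) • n := by
  obtain ⟨n, rfl⟩ := Submodule.Quotient.mk_surjective _ n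
  rw [zero_smul]
  refine (Submodule.Quotient.mk_eq_zero _).2 ?_
  refine Ideal.mul_mem_right _ _ (mem_indepIdeal (K := K).2 fun m hm h ↦ hx (h.1 ?_))
  simp [MvPolynomial.support_X] at hm
  simp [hm]

lemma subsingleton_ext_indepQuotient_pointModule {K : Type} [Field K] {V : Type}
    {G : SimpleGraph V} {W F : Finset V} {x : V} (hx : x ∉ W) (hF : x ∈ F) (i : ℕ) :
    Subsingleton (Abelian.Ext.{0} (indepQuotient K G W) (pointModule K F) i) := by
  refine subsingleton_of_forall_eq 0 fun e ↦ ?_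
  have h1 := ext_smul_eq_of_left _ _ (X_smul_indepQuotient_eq_zero hx) e
  rw [X_smul_ext_pointModule] at h1
  simpa [hF] using h1

open Classical in
lemma subsingleton_ext_indepQuotient_filter {K : Type} [Field K] {V : Type}
    {G : SimpleGraph V} {W F : Finset V} {x : V} (hx : x ∈ W) (hF : x ∈ F) {i : ℕ}
    (h : Subsingleton (Abelian.Ext.{0} (indepQuotient K G W) (pointModule K F) i)) :
    Subsingleton (Abelian.Ext.{0} (indepQuotient K G (W.filter fun y ↦ ¬ G.Adj x y))
      (pointModule K F) i) := by
  obtain ⟨f, g, w, hS⟩ := exists_shortExact_indepQuotient K G hx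
  have h3 := subsingleton_ext_indepQuotient_pointModule (K := K) (G := G)
    (Finset.notMem_erase x W) hF (1 + i)
  refine subsingleton_of_forall_eq 0 fun e ↦ ?_
  obtain ⟨e', rfl⟩ := Abelian.Ext.contravariant_sequence_exact₁ hS _ e rfl
    (h3.elim _ _)
  rw [h.elim e' 0, Abelian.Ext.comp_zero]

lemma not_subsingleton_ext_indepQuotient_bot (K : Type) [Field K] {V : Type} [Fintype V]
    {W F : Finset V} (hF : F ⊆ W) :
    ¬ Subsingleton (Abelian.Ext.{0} (indepQuotient K (⊥ : SimpleGraph V) W) (pointModule K F)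
      (Fintype.card V - W.card)) := by
  classical
  induction h : Fintype.card V - W.card generalizing W with
  | zero =>
    have hW : W = Finset.univ :=
      Finset.eq_univ_of_card W (le_antisymm (Finset.card_le_univ W) (by omega))
    subst hW
    rw [Abelian.Ext.homEquiv₀.subsingleton_congr, indepQuotient, indepIdeal_bot_univ]
    intro hsub
    have h0 := hsub.elim (ModuleCat.ofHom (Submodule.mapQ ⊥ _ LinearMap.id bot_le)) 0
    have h1 := LinearMap.congr_fun (ModuleCat.hom_ext_iff.1 h0) (Submodule.Quotient.mk 1)
    have h2 := (Submodule.Quotient.mk_eq_zero _).1 h1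
    simp [RingHom.mem_ker] at h2
  | succ n ih =>
    obtain ⟨x, hx⟩ : ∃ x, x ∉ W := by
      by_contra! h'
      rw [Finset.eq_univ_of_forall h', Finset.card_univ] at h
      omega
    obtain ⟨g, w, hS⟩ := exists_shortExact_indepQuotient_bot K hx
    intro hsub
    refine ih (hF.trans (Finset.subset_insert x W))
      (by rw [Finset.card_insert_of_notMem hx]; omega) (subsingleton_of_forall_eq 0 fun e ↦ ?_)
    obtain ⟨e', rfl⟩ := Abelian.Ext.contravariant_sequence_exact₁ hS _ e (add_comm 1 n)
      (hsub.elim _ _)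
    have hxF : x ∉ F := fun h ↦ hx (hF h)
    rw [Abelian.Ext.mk₀_smul, Abelian.Ext.smul_comp, X_smul_ext_pointModule]
    simp [hxF]

open Classical in
lemma subsingleton_ext_indepQuotient_filter_forall {K : Type} [Field K] {V : Type}
    {G : SimpleGraph V} {W F T : Finset V} (hF : IsIndepSet G F) (hFW : F ⊆ W) (hT : T ⊆ F) {i : ℕ}
    (h : Subsingleton (Abelian.Ext.{0} (indepQuotient K G W) (pointModule K F) i)) :
    Subsingleton (Abelian.Ext.{0} (indepQuotient K G (W.filter fun y ↦ ∀ x ∈ T, ¬ G.Adj x y))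
      (pointModule K F) i) := by
  induction T using Finset.induction_on with
  | empty => simpa using h
  | insert a T ha ih =>
    rw [Finset.insert_subset_iff] at hT
    have := subsingleton_ext_indepQuotient_filter (x := a)
      (by simpa [hFW hT.1] using fun x hx ↦ hF x (hT.2 hx) a hT.1) hT.1 (ih hT.2)
    simpa [Finset.filter_filter, and_comm] using this

lemma not_subsingleton_ext_indepQuotient (K : Type) [Field K] {V : Type} [Fintype V]
    {G : SimpleGraph V} {W F : Finset V} (hF : IsIndepSet G F) (hFW : F ⊆ W)
    (hmax : ∀ v ∈ W, v ∉ F → ∃ a ∈ F, G.Adj v a) :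
    ¬ Subsingleton (Abelian.Ext.{0} (indepQuotient K G W) (pointModule K F)
      (Fintype.card V - F.card)) := by
  classical
  intro h
  have := subsingleton_ext_indepQuotient_filter_forall hF hFW subset_rfl h
  have hfilter (_ : DecidablePred fun y ↦ ∀ x ∈ F, ¬ G.Adj x y) :
      (W.filter fun y ↦ ∀ x ∈ F, ¬ G.Adj x y) = F := by
    ext y
    rw [Finset.mem_filter]
    constructor
    · rintro ⟨hy, hy'⟩
      by_contra hyF
      obtain ⟨a, ha, hadj⟩ := hmax y hy hyF
      exact hy' a ha hadj.symm
    · exact fun hy ↦ ⟨hFW hy, fun x hx ↦ hF x hx y hy⟩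
  rw [hfilter, indepQuotient, indepIdeal_eq_of_isIndepSet K hF] at this
  exact not_subsingleton_ext_indepQuotient_bot K subset_rfl this

open Classical in
lemma hasProjectiveDimensionLT_indepQuotient (K : Type) [Field K] {V : Type} [Fintype V]
    (G : SimpleGraph V)
    (hG : ∀ W : Finset V, ¬ IsIndepSet G W →
      ∃ v ∈ W, ∃ x ∈ W, G.Adj v x ∧ ∀ u ∈ W, G.Adj v u → u = x ∨ G.Adj x u)
    (W : Finset V) (k : ℕ)
    (hk : ∀ F ⊆ W, IsIndepSet G F → (∀ v ∈ W, v ∉ F → ∃ a ∈ F, G.Adj v a) → k ≤ F.card) :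
    HasProjectiveDimensionLT (indepQuotient K G W) (Fintype.card V - k + 1) := by
  induction W using Finset.strongInduction with
  | H W ih =>
  by_cases hW : IsIndepSet G W
  · have hk' := hk W subset_rfl hW fun v hv hv' ↦ absurd hv hv'
    rw [indepQuotient, indepIdeal_eq_of_isIndepSet K hW]
    have := hasProjectiveDimensionLT_indepQuotient_bot K W
    exact hasProjectiveDimensionLT_of_ge _ (Fintype.card V - W.card + 1) _ (by omega)
  · obtain ⟨v, hv, x, hx, hvx, hdom⟩ := hG W hW
    obtain ⟨f, g, w, hS⟩ := exists_shortExact_indepQuotient K G hx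
    refine hS.hasProjectiveDimensionLT_X₂ _ (ih _ ?_ fun F hFW hF hmax ↦ hk F ?_ hF ?_)
      (ih _ (Finset.erase_ssubset hx) fun F hFW hF hmax ↦ hk F ?_ hF ?_)
    · exact Finset.filter_ssubset.2 ⟨v, hv, fun h ↦ h hvx.symm⟩
    · exact hFW.trans (Finset.filter_subset _ _)
    · intro u hu huF
      by_cases hxu : G.Adj x u
      · refine ⟨x, ?_, hxu.symm⟩
        by_contra hxF
        obtain ⟨a, ha, hadj⟩ := hmax x (by simp [hx]) hxF
        exact (Finset.mem_filter.1 (hFW ha)).2 hadj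
      · exact hmax u (by simp [hu, hxu]) huF
    · exact hFW.trans (Finset.erase_subset _ _)
    · intro u hu huF
      by_cases hux : u = x
      · subst hux
        by_cases hvF : v ∈ F
        · exact ⟨v, hvF, hvx.symm⟩
        · obtain ⟨a, ha, hadj⟩ := hmax v (by simp [hv, hvx.ne]) hvF
          have := Finset.mem_erase.1 (hFW ha)
          exact ⟨a, ha, (hdom a this.2 hadj).resolve_left this.1⟩
      · exact hmax u (by simp [hu, hux]) huF

lemma SimpleGraph.Walk.adj_mem_edges_of_forall_length_le {V : Type} {G : SimpleGraph V} {s t : V}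
    {P : V → Prop} (p : G.Walk s t) (hP : ∀ u ∈ p.support, P u)
    (hmin : ∀ q : G.Walk s t, (∀ u ∈ q.support, P u) → p.length ≤ q.length)
    {u w : V} (hu : u ∈ p.support) (hw : w ∈ p.support) (h : G.Adj u w) : s(u, w) ∈ p.edges := by
  obtain ⟨i, rfl, hi⟩ := SimpleGraph.Walk.mem_support_iff_exists_getVert.1 hu
  obtain ⟨j, rfl, hj⟩ := SimpleGraph.Walk.mem_support_iff_exists_getVert.1 hw
  clear hu hw
  wlog hij : i < j generalizing i j
  · rw [Sym2.eq_swap]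
    refine this j hj i hi h.symm (lt_of_le_of_ne (not_lt.1 hij) ?_)
    rintro rfl
    exact G.irrefl h
  have hlen := hmin ((p.take i).append (.cons h (p.drop j))) (by
    intro v hv
    rw [SimpleGraph.Walk.mem_support_append_iff, SimpleGraph.Walk.support_cons,
      List.mem_cons] at hv
    rcases hv with hv | rfl | hv
    · exact hP v (p.isSubwalk_take i |>.support_subset hv)
    · exact hP _ (p.getVert_mem_support i)
    · exact hP v (p.isSubwalk_drop j |>.support_subset hv))
  simp only [SimpleGraph.Walk.length_append, SimpleGraph.Walk.length_cons,
    SimpleGraph.Walk.take_length, SimpleGraph.Walk.drop_length] at hlen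
  obtain rfl : j = i + 1 := by omega
  exact SimpleGraph.Walk.adj_toSubgraph_iff_mem_edges.1 (p.toSubgraph_adj_getVert (by omega))

lemma IsChordal.adj_of_common_neighbor {V : Type} {G : SimpleGraph V} (hG : IsChordal G)
    {A : Set V} {s t b : V} (p : G.Walk s t) (hp : ∀ u ∈ p.support, u ∈ A ∨ u = s ∨ u = t)
    (hbA : b ∉ A) (hA : ∀ a ∈ A, ¬ G.Adj b a) (hst : s ≠ t)
    (hbs : G.Adj b s) (hbt : G.Adj b t) : G.Adj s t := by
  classical
  by_contra hadj
  let Q : Set ℕ := {n | ∃ q : G.Walk s t, (∀ u ∈ q.support, u ∈ A ∨ u = s ∨ u = t) ∧ q.length = n}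
  have hQ : Q.Nonempty := ⟨_, p, hp, rfl⟩
  obtain ⟨r, hr, hrlen⟩ := Nat.sInf_mem hQ
  have hqsupp := fun u hu ↦ hr u (r.support_bypass_subset_support hu)
  have hqmin : ∀ q : G.Walk s t, (∀ u ∈ q.support, u ∈ A ∨ u = s ∨ u = t) →
      r.bypass.length ≤ q.length := fun q hq ↦
    (r.length_bypass_le_length.trans hrlen.le).trans (Nat.sInf_le ⟨q, hq, rfl⟩)
  have hqpath := r.bypass_isPath
  generalize r.bypass = q at hqsupp hqmin hqpath
  have hbq : b ∉ q.support := fun h ↦ by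
    rcases hqsupp b h with h | rfl | rfl
    exacts [hbA h, G.irrefl hbs, G.irrefl hbt]
  have hlen : 2 ≤ q.length := by
    by_contra! hlt
    interval_cases h : q.length
    · exact hst (SimpleGraph.Walk.eq_of_length_eq_zero h)
    · exact hadj (SimpleGraph.Walk.adj_of_length_eq_one h)
  have hb : ∀ u ∈ q.support, G.Adj b u → u = s ∨ u = t := fun u hu h ↦
    (hqsupp u hu).resolve_left fun h' ↦ hA u h' h
  let c : G.Walk b b := .cons hbs (q.concat hbt.symm)
  have hc : c.IsCycle := by
    rw [SimpleGraph.Walk.cons_isCycle_iff]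
    refine ⟨hqpath.concat hbq _, fun h ↦ ?_⟩
    rw [SimpleGraph.Walk.edges_concat, List.concat_eq_append, List.mem_append] at h
    rcases h with h | h
    · exact hbq (q.fst_mem_support_of_mem_edges h)
    · simp only [List.mem_singleton, Sym2.eq_iff] at h
      grind
  obtain ⟨u, w, hu, hw, huw, hnot⟩ := hG b c hc (by simp [c]; omega)
  have hsupp : ∀ v, v ∈ c.support ↔ v = b ∨ v ∈ q.support := fun v ↦ by
    simp [c, SimpleGraph.Walk.support_concat]
    tauto
  have hbedge : ∀ v, v = s ∨ v = t → s(b, v) ∈ c.edges := by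
    rintro v (rfl | rfl) <;> simp [c, SimpleGraph.Walk.edges_concat, Sym2.eq_swap]
  rw [hsupp] at hu hw
  rcases hu with rfl | hu
  · rcases hw with rfl | hw
    · exact G.irrefl huw
    · exact hnot (hbedge w (hb w hw huw))
  · rcases hw with rfl | hw
    · rw [Sym2.eq_swap] at hnot
      exact hnot (hbedge u (hb u hu huw.symm))
    · refine hnot ?_
      have := q.adj_mem_edges_of_forall_length_le hqsupp hqmin hu hw huw
      simp [c, SimpleGraph.Walk.edges_concat, this]

lemma IsChordal.exists_simplicial {V : Type} {G : SimpleGraph V} (hG : IsChordal G)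
    (W : Finset V) (hW : W.Nonempty) :
    ∃ v ∈ W, ∀ u ∈ W, ∀ w ∈ W, G.Adj v u → G.Adj v w → u ≠ w → G.Adj u w := by
  classical
  induction W using Finset.strongInduction with
  | H W ih =>
  by_cases hcomplete : ∀ u ∈ W, ∀ w ∈ W, u ≠ w → G.Adj u w
  · obtain ⟨v, hv⟩ := hW
    exact ⟨v, hv, fun u hu w hw _ _ ↦ hcomplete u hu w hw⟩
  push Not at hcomplete
  obtain ⟨v₀, hv₀, w₀, hw₀, hne, hnadj⟩ := hcomplete
  let IsConn (A : Finset V) : Prop := ∀ a ∈ A, ∀ b ∈ A, ∃ p : G.Walk a b, ∀ u ∈ p.support, u ∈ A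
  let P (A : Finset V) : Prop := A ⊆ W ∧ A.Nonempty ∧ IsConn A ∧
    ∃ b ∈ W, b ∉ A ∧ ∀ a ∈ A, ¬ G.Adj b a
  have hP₀ : P {v₀} := by
    refine ⟨by simpa, by simp, ?_, w₀, hw₀, by simpa using hne.symm, ?_⟩
    · intro a ha b hb
      obtain rfl := Finset.mem_singleton.1 ha
      obtain rfl := Finset.mem_singleton.1 hb
      exact ⟨.nil, by simp⟩
    · simpa [G.adj_comm] using hnadj
  obtain ⟨A, ⟨hAW, hAne, hAconn, hAb⟩, hAmax⟩ : ∃ A, P A ∧ ∀ A', P A' → A'.card ≤ A.card := by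
    obtain ⟨A, hA, hmax⟩ := (W.powerset.filter P).exists_max_image Finset.card
      ⟨{v₀}, by simpa using ⟨hv₀, hP₀⟩⟩
    rw [Finset.mem_filter] at hA
    exact ⟨A, hA.2, fun A' hA' ↦ hmax A' (by simp [hA', hA'.1])⟩
  let B := W.filter fun b ↦ b ∉ A ∧ ∀ a ∈ A, ¬ G.Adj b a
  have hBW : B ⊂ W := by
    obtain ⟨a, ha⟩ := hAne
    exact Finset.filter_ssubset.2 ⟨a, hAW ha, fun h ↦ h.1 ha⟩
  have hBne : B.Nonempty := by
    obtain ⟨b, hb, hb'⟩ := hAb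
    exact ⟨b, Finset.mem_filter.2 ⟨hb, hb'⟩⟩
  have hjoin : ∀ s ∈ W, s ∉ A → s ∉ B → ∀ b ∈ B, G.Adj b s := by
    intro s hs hsA hsB b hb
    by_contra hbs
    have hex : ∃ a ∈ A, G.Adj s a := by
      by_contra! h
      exact hsB (Finset.mem_filter.2 ⟨hs, hsA, h⟩)
    obtain ⟨a, ha, hsa⟩ := hex
    have hbW := Finset.mem_filter.1 hb
    have := hAmax (insert s A) ⟨Finset.insert_subset hs hAW, by simp, ?_, b, hbW.1, ?_, ?_⟩
    · rw [Finset.card_insert_of_notMem hsA] at this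
      omega
    · intro x hx y hy
      rw [Finset.mem_insert] at hx hy
      rcases hx with rfl | hx <;> rcases hy with rfl | hy
      · exact ⟨.nil, by simp⟩
      · obtain ⟨p, hp⟩ := hAconn a ha y hy
        refine ⟨.cons hsa p, fun u hu ↦ ?_⟩
        rw [SimpleGraph.Walk.support_cons, List.mem_cons] at hu
        exact Finset.mem_insert.2 (hu.imp_right (hp u))
      · obtain ⟨p, hp⟩ := hAconn x hx a ha
        refine ⟨p.concat hsa.symm, fun u hu ↦ ?_⟩
        rw [SimpleGraph.Walk.support_concat, List.mem_append,
          List.mem_singleton] at hu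
        exact Finset.mem_insert.2 (hu.symm.imp_right (hp u))
      · obtain ⟨p, hp⟩ := hAconn x hx y hy
        exact ⟨p, fun u hu ↦ Finset.mem_insert_of_mem (hp u hu)⟩
    · rw [Finset.mem_insert, not_or]
      exact ⟨fun h ↦ hsB (h ▸ hb), hbW.2.1⟩
    · intro x hx
      rcases Finset.mem_insert.1 hx with rfl | hx
      exacts [hbs, hbW.2.2 x hx]
  have hclique : ∀ s ∈ W, s ∉ A → s ∉ B → ∀ t ∈ W, t ∉ A → t ∉ B → s ≠ t → G.Adj s t := by
    intro s hs hsA hsB t ht htA htB hst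
    obtain ⟨b, hb⟩ := hBne
    have hbW := Finset.mem_filter.1 hb
    obtain ⟨a, ha, hsa⟩ : ∃ a ∈ A, G.Adj s a := by
      by_contra! h
      exact hsB (Finset.mem_filter.2 ⟨hs, hsA, h⟩)
    obtain ⟨a', ha', hta⟩ : ∃ a ∈ A, G.Adj t a := by
      by_contra! h
      exact htB (Finset.mem_filter.2 ⟨ht, htA, h⟩)
    obtain ⟨p, hp⟩ := hAconn a ha a' ha'
    refine hG.adj_of_common_neighbor (A := A) (.cons hsa (p.concat hta.symm)) ?_ hbW.2.1 hbW.2.2 hst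
      (hjoin s hs hsA hsB b hb) (hjoin t ht htA htB b hb)
    intro u hu
    simp only [SimpleGraph.Walk.support_cons, SimpleGraph.Walk.support_concat,
      List.mem_cons, List.mem_append, List.not_mem_nil, or_false] at hu
    rcases hu with h | h | h
    exacts [.inr (.inl h), .inl (hp u h), .inr (.inr h)]
  obtain ⟨v, hv, hsimp⟩ := ih B hBW hBne
  have hvW := Finset.mem_filter.1 hv
  refine ⟨v, hvW.1, fun u hu w hw hvu hvw huw ↦ ?_⟩
  have huA : u ∉ A := fun h ↦ hvW.2.2 u h hvu
  have hwA : w ∉ A := fun h ↦ hvW.2.2 w h hvw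
  by_cases huB : u ∈ B <;> by_cases hwB : w ∈ B
  · exact hsimp u huB w hwB hvu hvw huw
  · exact hjoin w hw hwA hwB u huB
  · exact (hjoin u hu huA huB w hwB).symm
  · exact hclique u hu huA huB w hw hwA hwB huw

lemma IsChordal.exists_dominated_neighbor {V : Type} {G : SimpleGraph V} (hG : IsChordal G)
    (W : Finset V) (hW : ¬ IsIndepSet G W) :
    ∃ v ∈ W, ∃ x ∈ W, G.Adj v x ∧ ∀ u ∈ W, G.Adj v u → u = x ∨ G.Adj x u := by
  classical
  simp only [IsIndepSet, not_forall, not_not] at hW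
  obtain ⟨a, ha, b, hb, hab⟩ := hW
  obtain ⟨v, hv, hsimp⟩ := hG.exists_simplicial (W.filter fun v ↦ ∃ x ∈ W, G.Adj v x)
    ⟨a, Finset.mem_filter.2 ⟨ha, b, hb, hab⟩⟩
  obtain ⟨hvW, x, hx, hvx⟩ := Finset.mem_filter.1 hv
  refine ⟨v, hvW, x, hx, hvx, fun u hu hvu ↦ or_iff_not_imp_left.2 fun hne ↦ ?_⟩
  exact hsimp x (Finset.mem_filter.2 ⟨hx, v, hvW, hvx.symm⟩) u
    (Finset.mem_filter.2 ⟨hu, v, hvW, hvu.symm⟩) hvx hvu (Ne.symm hne)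

lemma exists_isDominatingSet_isIndepSet {V : Type} [Fintype V] (G : SimpleGraph V) :
    ∃ A : Set V, IsDominatingSet G A ∧ IsIndepSet G A := by
  obtain ⟨A, hA, hmax⟩ := (Set.toFinite {A : Set V | IsIndepSet G A}).exists_maximal
    ⟨∅, fun u hu ↦ hu.elim⟩
  refine ⟨A, fun v hv ↦ ?_, hA⟩
  by_contra! h
  refine hv (hmax (y := insert v A) ?_ (Set.subset_insert v A) (Set.mem_insert v A))
  rintro u (rfl | hu) w (rfl | hw)
  exacts [G.irrefl, h w hw, fun h' ↦ h u hu h'.symm, hA u hu w hw]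

lemma projDim_le_of_hasProjectiveDimensionLT {R : Type} [CommRing R] (M : ModuleCat.{0} R) (d : ℕ)
    (h : HasProjectiveDimensionLT M (d + 1)) : projDim R M ≤ d := by
  refine sSup_le ?_
  rintro _ ⟨i, N, rfl, hi⟩
  by_contra! hlt
  rw [Nat.cast_lt] at hlt
  obtain ⟨j, rfl⟩ : ∃ j, i = j + 1 := ⟨i - 1, by omega⟩
  exact not_subsingleton_iff_nontrivial.2 hi ((subsingleton_derivedExt_succ_iff M N j).2
    (HasProjectiveDimensionLT.subsingleton M (d + 1) (j + 1) (by omega) N))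

lemma le_projDim_of_not_subsingleton {R : Type} [CommRing R] (M N : ModuleCat.{0} R) (d : ℕ)
    (h : ¬ Subsingleton (Abelian.Ext.{0} M N d)) : (d : ℕ∞) ≤ projDim R M := by
  cases d with
  | zero => simp
  | succ d =>
    refine le_sSup ⟨d + 1, N, rfl, not_subsingleton_iff_nontrivial.1 fun h' ↦ h ?_⟩
    exact (subsingleton_derivedExt_succ_iff M N d).1 h'

/-- For a chordal graph, pd(G) = n - i(G), stated as pd(G) + i(G) = n. -/
theorem stmt18 (K : Type) [Field K] {V : Type} [Fintype V] (G : SimpleGraph V)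
    (hchordal : IsChordal G) :
    graphPd K G + (indDomNum G : ℕ∞) = (Fintype.card V : ℕ∞) := by
  classical
  have hquot : ModuleCat.of (MvPolynomial V K) (MvPolynomial V K ⧸ edgeIdeal K G) =
      indepQuotient K G Finset.univ := by
    rw [indepQuotient, indepIdeal_univ]
  obtain ⟨A, hdom, hind, hcard⟩ : indDomNum G ∈
      {n | ∃ A : Set V, IsDominatingSet G A ∧ IsIndepSet G A ∧ A.ncard = n} :=
    Nat.sInf_mem (by
      obtain ⟨A, hA, hA'⟩ := exists_isDominatingSet_isIndepSet G
      exact ⟨_, A, hA, hA', rfl⟩)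
  lift A to Finset V using A.toFinite
  rw [Set.ncard_coe_finset] at hcard
  have hpd : graphPd K G = (Fintype.card V - indDomNum G : ℕ) := by
    rw [graphPd, hquot]
    apply le_antisymm
    · refine projDim_le_of_hasProjectiveDimensionLT _ _
        (hasProjectiveDimensionLT_indepQuotient K G hchordal.exists_dominated_neighbor _ _ ?_)
      intro F _ hF hmax
      rw [← Set.ncard_coe_finset]
      exact Nat.sInf_le ⟨F, fun v hv ↦ hmax v (Finset.mem_univ v) hv, hF, rfl⟩
    · rw [← hcard]
      exact le_projDim_of_not_subsingleton _ _ _ (not_subsingleton_ext_indepQuotient K hind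
        (Finset.subset_univ A) fun v _ hv ↦ hdom v hv)
  rw [hpd, ← Nat.cast_add, Nat.sub_add_cancel (hcard ▸ A.card_le_univ)]
end
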